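/- Let R₁, R₂, R₃ be Boolean random variables and Z : Ω → χ a random variable with finite value type, and suppose the joint distribution of (R₁, R₂, R₃, Z) assigns positive probability to every value combination. If R₁ ⊥ R₃ | (Z, R₂), then the conditional odds ratio of R₁ and R₂ given Z may be computed entirely within the stratum R₃ = 1: for all r₁, r₂ and all z, OR(r₁, r₂ | {Z = z}) = [P(R₁ = r₁ | R₂ = r₂, Z = z, R₃ = 1) / P(R₁ = 1 | R₂ = r₂, Z = z, R₃ = 1)] · [P(R₁ = 1 | R₂ = 1, Z = z, R₃ = 1) / P(R₁ = r₁ | R₂ = 1, Z = z, R₃ = 1)]. (This is the displayed derivation identifying OR(R₂, R₁ | Z₃⁽¹⁾) from observed data in the Figure 6(a) example of Theorem 4.) -/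

import Mathlib

open scoped BigOperators

/-- Probability of the event `A` under the (finitely supported) law `P`. -/
noncomputable def Pr {Ω : Type*} [Fintype Ω] (P : Ω → ℝ) (A : Set Ω) : ℝ :=
  ∑ ω, A.indicator P ω

/-- Conditional probability `P(A | B) = P(A ∩ B) / P(B)`. -/
noncomputable def cPr {Ω : Type*} [Fintype Ω] (P : Ω → ℝ) (A B : Set Ω) : ℝ :=
  Pr P (A ∩ B) / Pr P B

/-- The conditional odds ratio
`OR(r₁, r₂ | E) = [P(R₁=r₁ | R₂=r₂, E) / P(R₁=1 | R₂=r₂, E)]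
  · [P(R₁=1 | R₂=1, E) / P(R₁=r₁ | R₂=1, E)]`. -/
noncomputable def ORcond {Ω : Type*} [Fintype Ω] (P : Ω → ℝ) (R₁ R₂ : Ω → Bool)
    (E : Set Ω) (r₁ r₂ : Bool) : ℝ :=
  (cPr P {ω | R₁ ω = r₁} ({ω | R₂ ω = r₂} ∩ E)
      / cPr P {ω | R₁ ω = true} ({ω | R₂ ω = r₂} ∩ E))
    * (cPr P {ω | R₁ ω = true} ({ω | R₂ ω = true} ∩ E)
      / cPr P {ω | R₁ ω = r₁} ({ω | R₂ ω = true} ∩ E))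

theorem Pr_mono {Ω : Type*} [Fintype Ω] {P : Ω → ℝ} (hP : ∀ ω, 0 ≤ P ω) {A B : Set Ω}
    (h : A ⊆ B) : Pr P A ≤ Pr P B :=
  Finset.sum_le_sum fun ω _ => Set.indicator_le_indicator_of_subset h hP ω

/-- If `A` and `D` are conditionally independent given `C`, then conditioning further on `D`
does not change the conditional probability of `A`. -/
theorem cPr_inter_eq_of_condIndep {Ω : Type*} [Fintype Ω] {P : Ω → ℝ} {A C D : Set Ω}
    (hC : Pr P C ≠ 0) (hCD : Pr P (C ∩ D) ≠ 0)
    (h : cPr P (A ∩ D) C = cPr P A C * cPr P D C) : cPr P A (C ∩ D) = cPr P A C := by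
  have hD : cPr P D C ≠ 0 := by
    rw [cPr, Set.inter_comm]
    exact div_ne_zero hCD hC
  refine mul_right_cancel₀ hD (Eq.trans ?_ h)
  rw [cPr, cPr, cPr, Set.inter_comm D C, div_mul_div_cancel₀ hCD, Set.inter_comm C D,
    Set.inter_assoc]

/-- If `R₁ ⊥ R₃ | (Z, R₂)`, then the conditional odds ratio of `R₁` and `R₂`
given `Z = z` may be computed entirely within the stratum `R₃ = 1`
(the displayed derivation of the Figure 6(a) example of Theorem 4). -/
theorem stmt_7 {Ω χ : Type*} [Fintype Ω] [Fintype χ] [Nonempty χ]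
    (P : Ω → ℝ) (hP : ∀ ω, 0 ≤ P ω) (hPsum : ∑ ω, P ω = 1)
    (R₁ R₂ R₃ : Ω → Bool) (Z : Ω → χ)
    (hpos : ∀ (a b c : Bool) (z : χ),
      0 < Pr P {ω | R₁ ω = a ∧ R₂ ω = b ∧ R₃ ω = c ∧ Z ω = z})
    (hCI : ∀ (z : χ) (b : Bool) (a c : Bool),
      cPr P {ω | R₁ ω = a ∧ R₃ ω = c} {ω | Z ω = z ∧ R₂ ω = b}
        = cPr P {ω | R₁ ω = a} {ω | Z ω = z ∧ R₂ ω = b}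
          * cPr P {ω | R₃ ω = c} {ω | Z ω = z ∧ R₂ ω = b}) :
    ∀ (r₁ r₂ : Bool) (z : χ),
      ORcond P R₁ R₂ {ω | Z ω = z} r₁ r₂
        = ORcond P R₁ R₂ {ω | Z ω = z ∧ R₃ ω = true} r₁ r₂ := by
  intro r₁ r₂ z
  have key (a b : Bool) : cPr P {ω | R₁ ω = a} ({ω | R₂ ω = b} ∩ {ω | Z ω = z ∧ R₃ ω = true})
      = cPr P {ω | R₁ ω = a} ({ω | R₂ ω = b} ∩ {ω | Z ω = z}) := by
    have hC : {ω | R₂ ω = b} ∩ {ω | Z ω = z} = {ω | Z ω = z ∧ R₂ ω = b} :=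
      Set.inter_comm _ _
    have hCD : {ω | R₂ ω = b} ∩ {ω | Z ω = z ∧ R₃ ω = true}
        = {ω | Z ω = z ∧ R₂ ω = b} ∩ {ω | R₃ ω = true} := by
      rw [← hC, Set.inter_assoc]
      rfl
    rw [hC, hCD]
    refine cPr_inter_eq_of_condIndep (ne_of_gt ?_) (ne_of_gt ?_) (hCI z b a true)
    · exact (hpos a b true z).trans_le (Pr_mono hP fun ω h => ⟨h.2.2.2, h.2.1⟩)
    · exact (hpos a b true z).trans_le (Pr_mono hP fun ω h => ⟨⟨h.2.2.2, h.2.1⟩, h.2.2.1⟩)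
  simp only [ORcond, key]
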